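/- Let n ≥ 1 be an integer and let A_1, …, A_n and B_1, …, B_n be measurable subsets of positive measure of the circle T = ℝ/ℤ. Let A'_1, …, A'_n and B'_1, …, B'_n be closed intervals in T, each centred at 0, with |A'_i| = |A_i| and |B'_i| = |B_i| for each i. Then for b_i chosen independently and uniformly at random from B_i and b'_i chosen independently and uniformly at random from B'_i, one has E(|⋃_{i=1}^n (A_i + b_i)|) ≥ E(|⋃_{i=1}^n (A'_i + b'_i)|). -/

import Mathlib

open MeasureTheory

/-- The circle `ℝ/ℤ`. -/
abbrev 𝕋 := AddCircle (1 : ℝ)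

/-- The expected (Haar) measure of `⋃ i, (A i + b i)` in the circle `𝕋`, where each `b i`
is chosen independently and uniformly at random from `B i`. -/
noncomputable def expUnionT1 {n : ℕ} (A B : Fin n → Set 𝕋) : ℝ :=
  ((∏ i, volume (B i))⁻¹ *
    ∫⁻ b in Set.univ.pi B, volume (⋃ i, (· + b i) '' (A i))).toReal

open Set
open scoped ENNReal

lemma lintegral_min_le_of_tail_le {m m' : ℝ → ℝ≥0∞} (hm' : Antitone m')
    (h : ∀ c : ℝ, 0 ≤ c → ∫⁻ t in Ioi c, m t ≤ ∫⁻ t in Ioi c, m' t) (v : ℝ≥0∞) :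
    ∫⁻ t in Ioi (0 : ℝ), min v (m t) ≤ ∫⁻ t in Ioi (0 : ℝ), min v (m' t) := by
  set S : Set ℝ := {t | 0 < t ∧ m' t ≤ v} with hS
  rcases S.eq_empty_or_nonempty with hE | hE
  · refine setLIntegral_mono' measurableSet_Ioi fun t ht => ?_
    have : v ≤ m' t := by
      by_contra hlt
      exact (hE ▸ (show t ∈ S from ⟨ht, (not_le.mp hlt).le⟩) : t ∈ (∅ : Set ℝ))
    rw [min_eq_left this]
    exact min_le_left _ _
  · have hbdd : BddBelow S := ⟨0, fun t ht => ht.1.le⟩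
    set c := sInf S with hc
    have hc0 : 0 ≤ c := le_csInf hE fun t ht => ht.1.le
    have hsplit (f : ℝ → ℝ≥0∞) :
        ∫⁻ t in Ioi (0 : ℝ), f t = (∫⁻ t in Ioo 0 c, f t) + ∫⁻ t in Ioi c, f t := by
      rw [← Ioc_union_Ioi_eq_Ioi hc0, lintegral_union measurableSet_Ioi,
        setLIntegral_congr Ioo_ae_eq_Ioc]
      exact Set.disjoint_left.mpr fun t ht ht' => not_lt.mpr ht.2 ht'
    rw [hsplit, hsplit]
    refine add_le_add (setLIntegral_mono' measurableSet_Ioo fun t ht => ?_) ?_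
    · have : v ≤ m' t := by
        by_contra hlt
        exact not_lt.mpr (csInf_le hbdd ⟨ht.1, (not_le.mp hlt).le⟩) ht.2
      rw [min_eq_left this]
      exact min_le_left _ _
    · calc ∫⁻ t in Ioi c, min v (m t) ≤ ∫⁻ t in Ioi c, m t :=
            lintegral_mono fun t => min_le_right _ _
        _ ≤ ∫⁻ t in Ioi c, m' t := h c hc0
        _ = ∫⁻ t in Ioi c, min v (m' t) := by
            refine setLIntegral_congr_fun measurableSet_Ioi fun t ht => ?_
            obtain ⟨s, hs, hst⟩ := exists_lt_of_csInf_lt hE ht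
            exact (min_eq_right ((hm' hst.le).trans hs.2)).symm

lemma lintegral_pi_min_iInf_le (ν : Measure ℝ) [SigmaFinite ν] {n : ℕ}
    {m m' : Fin n → ℝ → ℝ≥0∞} (hm : ∀ i, Antitone (m i)) (hm' : ∀ i, Antitone (m' i))
    (h : ∀ i v, ∫⁻ t, min v (m i t) ∂ν ≤ ∫⁻ t, min v (m' i t) ∂ν) (v : ℝ≥0∞) :
    ∫⁻ t, min v (⨅ i, m i (t i)) ∂(Measure.pi fun _ => ν) ≤
      ∫⁻ t, min v (⨅ i, m' i (t i)) ∂(Measure.pi fun _ => ν) := by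
  induction n generalizing v with
  | zero => simp
  | succ n ih =>
    have key (k : Fin (n + 1) → ℝ → ℝ≥0∞) :
        ∫⁻ t, min v (⨅ i, k i (t i)) ∂(Measure.pi fun _ => ν) =
          ∫⁻ p : ℝ × (Fin n → ℝ), min v (min (k 0 p.1) (⨅ i, k i.succ (p.2 i)))
            ∂(ν.prod (Measure.pi fun _ => ν)) := by
      rw [← (measurePreserving_piFinSuccAbove (fun _ : Fin (n + 1) => ν) 0).lintegral_comp_emb
        (MeasurableEquiv.measurableEmbedding _)]
      refine lintegral_congr fun t => ?_
      congr 1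
      refine le_antisymm (le_min (iInf_le _ _) (le_iInf fun i => iInf_le _ _)) (le_iInf fun i => ?_)
      refine Fin.cases (min_le_left _ _) (fun j => (min_le_right _ _).trans (iInf_le _ j)) i
    have hmeas (k k' : Fin (n + 1) → ℝ → ℝ≥0∞) (hk : ∀ i, Antitone (k i))
        (hk' : ∀ i, Antitone (k' i)) : Measurable fun p : ℝ × (Fin n → ℝ) =>
          min v (min (k 0 p.1) (⨅ i, k' i.succ (p.2 i))) := by
      have h0 := (hk 0).measurable
      have h1 := fun i : Fin n => (hk' i.succ).measurable
      fun_prop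
    rw [key m, key m']
    calc _ = ∫⁻ x, ∫⁻ y, min (min v (m 0 x)) (⨅ i : Fin n, m i.succ (y i))
              ∂(Measure.pi fun _ => ν) ∂ν := by
          rw [lintegral_prod _ (hmeas m m hm hm).aemeasurable]
          simp only [min_assoc]
      _ ≤ ∫⁻ x, ∫⁻ y, min (min v (m 0 x)) (⨅ i : Fin n, m' i.succ (y i))
              ∂(Measure.pi fun _ => ν) ∂ν :=
          lintegral_mono fun x =>
            ih (fun i => hm i.succ) (fun i => hm' i.succ) (fun i => h i.succ) _
      _ = ∫⁻ y, ∫⁻ x, min (min v (⨅ i : Fin n, m' i.succ (y i))) (m 0 x)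
              ∂ν ∂(Measure.pi fun _ => ν) := by
          simp_rw [min_assoc]
          rw [← lintegral_prod (fun p : ℝ × (Fin n → ℝ) =>
              min v (min (m 0 p.1) (⨅ i : Fin n, m' i.succ (p.2 i)))) (hmeas m m' hm hm').aemeasurable,
            lintegral_prod_symm _ (hmeas m m' hm hm').aemeasurable]
          simp only [min_comm (m 0 _)]
      _ ≤ ∫⁻ y, ∫⁻ x, min (min v (⨅ i : Fin n, m' i.succ (y i))) (m' 0 x)
              ∂ν ∂(Measure.pi fun _ => ν) := lintegral_mono fun y => h 0 _
      _ = _ := by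
          rw [lintegral_prod_symm _ (hmeas m' m' hm' hm').aemeasurable]
          simp only [min_assoc, min_comm (m' 0 _)]

lemma antitone_measure_lt {Ω : Type*} [MeasurableSpace Ω] (μ : Measure Ω) (g : Ω → ℝ) :
    Antitone fun t => μ {x | t < g x} :=
  fun _ _ hst => measure_mono fun _ hx => lt_of_le_of_lt hst hx

lemma lintegral_ofReal_sub_eq {Ω : Type*} [MeasurableSpace Ω] (μ : Measure Ω)
    {g : Ω → ℝ} (hg : Measurable g) (c : ℝ) :
    ∫⁻ x, ENNReal.ofReal (g x - c) ∂μ = ∫⁻ t in Ioi c, μ {x | t < g x} := by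
  have h := lintegral_eq_lintegral_meas_lt μ (f := fun x => max (g x - c) 0)
    (Filter.Eventually.of_forall fun x => le_max_right _ _) (by fun_prop)
  simp only [ENNReal.ofReal_max, ENNReal.ofReal_zero, max_eq_left zero_le] at h
  rw [h, ← (measurePreserving_add_right volume c).setLIntegral_comp_preimage_emb
    (measurableEmbedding_addRight c) _ (Ioi c)]
  simp only [preimage_add_const_Ioi, sub_self]
  refine setLIntegral_congr_fun measurableSet_Ioi fun t ht => ?_
  congr 1
  ext x
  simp only [lt_max_iff, mem_ofPred_eq, lt_sub_iff_add_lt]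
  exact or_iff_left (not_lt.mpr (le_of_lt ht))

lemma lintegral_prod_ofReal_eq {Ω : Type*} [MeasurableSpace Ω] (μ : Measure Ω) [SFinite μ]
    {n : ℕ} {g : Fin n → Ω → ℝ} (hg : ∀ i, Measurable (g i)) :
    ∫⁻ x, ∏ i, ENNReal.ofReal (g i x) ∂μ =
      ∫⁻ t, μ {x | ∀ i, t i < g i x} ∂(Measure.pi fun _ => volume.restrict (Ioi (0 : ℝ))) := by
  have hS : MeasurableSet {p : Ω × (Fin n → ℝ) | ∀ i, p.2 i < g i p.1} := by
    rw [ofPred_forall]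
    exact MeasurableSet.iInter fun i => measurableSet_lt (by fun_prop) (by fun_prop)
  have h1 := Measure.prod_apply (μ := μ)
    (ν := Measure.pi fun _ : Fin n => volume.restrict (Ioi (0 : ℝ))) hS
  rw [Measure.prod_apply_symm hS] at h1
  refine Eq.trans (lintegral_congr fun x => ?_) h1.symm
  have : Prod.mk x ⁻¹' {p : Ω × (Fin n → ℝ) | ∀ i, p.2 i < g i p.1} =
      Set.univ.pi fun i => Iio (g i x) := by
    ext t; simp
  rw [this, Measure.pi_pi]
  refine Finset.prod_congr rfl fun i _ => ?_
  rw [Measure.restrict_apply measurableSet_Iio, Iio_inter_Ioi, Real.volume_Ioo, sub_zero]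

lemma lintegral_prod_le_of_majorized {Ω : Type*} [MeasurableSpace Ω] (μ : Measure Ω)
    [IsProbabilityMeasure μ] {n : ℕ} {g g' : Fin n → Ω → ℝ} (hg : ∀ i, Measurable (g i))
    (hg' : ∀ i, Measurable (g' i))
    (hmaj : ∀ i c, 0 ≤ c →
      ∫⁻ x, ENNReal.ofReal (g i x - c) ∂μ ≤ ∫⁻ x, ENNReal.ofReal (g' i x - c) ∂μ)
    (hco : ∀ x y, (∀ i, g' i x ≤ g' i y) ∨ (∀ i, g' i y ≤ g' i x)) :
    ∫⁻ x, ∏ i, ENNReal.ofReal (g i x) ∂μ ≤ ∫⁻ x, ∏ i, ENNReal.ofReal (g' i x) ∂μ := by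
  rw [lintegral_prod_ofReal_eq μ hg, lintegral_prod_ofReal_eq μ hg']
  have hinter (t : Fin n → ℝ) :
      min 1 (⨅ i, μ {x | t i < g' i x}) ≤ μ {x | ∀ i, t i < g' i x} := by
    by_cases hall : ∀ x, ∀ i, t i < g' i x
    · simp [hall]
    · push Not at hall
      have htot (i j : Fin n) : {x | t i < g' i x} ⊆ {x | t j < g' j x} ∨
          {x | t j < g' j x} ⊆ {x | t i < g' i x} := by
        by_contra! hcon
        obtain ⟨h1, h2⟩ := hcon
        obtain ⟨x, hx1, hx2⟩ := not_subset.mp h1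
        obtain ⟨y, hy1, hy2⟩ := not_subset.mp h2
        simp only [mem_ofPred_eq, not_lt] at hx1 hx2 hy1 hy2
        rcases hco x y with hxy | hxy
        · linarith [hxy i]
        · linarith [hxy j]
      obtain ⟨_, i₀, _⟩ := hall
      have hne : (Set.range fun i => {x | t i < g' i x}).Nonempty := ⟨_, i₀, rfl⟩
      obtain ⟨s, ⟨i, rfl⟩, hmin⟩ := (Set.finite_range fun i => {x | t i < g' i x}).exists_minimal hne
      refine (min_le_right _ _).trans ((iInf_le _ i).trans (measure_mono fun x hx j => ?_))
      rcases htot i j with hij | hij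
      · exact hij hx
      · exact hmin ⟨j, rfl⟩ hij hx
  calc _ ≤ ∫⁻ t, min 1 (⨅ i, μ {x | t i < g i x})
          ∂(Measure.pi fun _ => volume.restrict (Ioi (0 : ℝ))) :=
        lintegral_mono fun t => le_min prob_le_one
          (le_iInf fun i => measure_mono fun x (hx : ∀ i, t i < g i x) => hx i)
    _ ≤ ∫⁻ t, min 1 (⨅ i, μ {x | t i < g' i x})
          ∂(Measure.pi fun _ => volume.restrict (Ioi (0 : ℝ))) := by
        refine lintegral_pi_min_iInf_le _ (m := fun i t => μ {x | t < g i x})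
          (m' := fun i t => μ {x | t < g' i x}) (fun i => antitone_measure_lt μ _)
          (fun i => antitone_measure_lt μ _) (fun i v => ?_) 1
        refine lintegral_min_le_of_tail_le (antitone_measure_lt μ _) (fun c hc => ?_) v
        rw [← lintegral_ofReal_sub_eq μ (hg i), ← lintegral_ofReal_sub_eq μ (hg' i)]
        exact hmaj i c hc
    _ ≤ _ := lintegral_mono hinter

/-- The measure of `B ∩ (x - A)`, that is, the convolution of the indicators of `A` and `B`. -/
noncomputable def overlap (A B : Set 𝕋) (x : 𝕋) : ℝ :=
  volume.real {b | b ∈ B ∧ x - b ∈ A}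

instance : IsProbabilityMeasure (volume : Measure 𝕋) :=
  ⟨by simp [AddCircle.measure_univ]⟩

lemma volume_preimage_sub_right (A : Set 𝕋) (y : 𝕋) :
    volume ((fun b => b - y) ⁻¹' A) = volume A := by
  simpa only [sub_eq_add_neg] using measure_preimage_add_right volume (-y) A

lemma volume_preimage_sub_left (A : Set 𝕋) (x : 𝕋) :
    volume ((fun b => x - b) ⁻¹' A) = volume A :=
  (Measure.measurePreserving_sub_left volume x).measure_preimage_emb
    (MeasurableEquiv.subLeft x).measurableEmbedding A

lemma measurableSet_overlap {A B : Set 𝕋} (hA : MeasurableSet A) (hB : MeasurableSet B) :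
    MeasurableSet {p : 𝕋 × 𝕋 | p.2 ∈ B ∧ p.1 - p.2 ∈ A} :=
  (measurable_snd hB).inter ((measurable_fst.sub measurable_snd) hA)

lemma measurable_overlap {A B : Set 𝕋} (hA : MeasurableSet A) (hB : MeasurableSet B) :
    Measurable (overlap A B) :=
  (measurable_measure_prodMk_left (measurableSet_overlap hA hB)).ennreal_toReal

lemma overlap_nonneg (A B : Set 𝕋) (x : 𝕋) : 0 ≤ overlap A B x := measureReal_nonneg

lemma overlap_le_right (A B : Set 𝕋) (x : 𝕋) : overlap A B x ≤ volume.real B :=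
  measureReal_mono fun _ hb => hb.1

lemma volume_real_sub_left (A : Set 𝕋) (x : 𝕋) :
    volume.real ((fun b => x - b) ⁻¹' A) = volume.real A := by
  rw [measureReal_def, measureReal_def]
  congr 1
  exact volume_preimage_sub_left A x

lemma overlap_le_left (A B : Set 𝕋) (x : 𝕋) : overlap A B x ≤ volume.real A := by
  rw [← volume_real_sub_left A x]
  exact measureReal_mono fun _ hb => hb.2

lemma le_overlap {A : Set 𝕋} (hA : MeasurableSet A) (B : Set 𝕋) (x : 𝕋) :
    volume.real A + volume.real B - 1 ≤ overlap A B x := by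
  have hm : MeasurableSet ((fun b => x - b) ⁻¹' A) := measurable_id.const_sub x hA
  have h := measureReal_union_add_inter (μ := (volume : Measure 𝕋)) (s := B) hm
  rw [volume_real_sub_left] at h
  have h1 : volume.real (B ∪ (fun b => x - b) ⁻¹' A) ≤ 1 := measureReal_le_one
  have h2 : overlap A B x = volume.real (B ∩ (fun b => x - b) ⁻¹' A) := rfl
  linarith

lemma integrable_overlap {A B : Set 𝕋} (hA : MeasurableSet A) (hB : MeasurableSet B) :
    Integrable (overlap A B) :=
  Integrable.of_bound (measurable_overlap hA hB).aestronglyMeasurable (volume.real B)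
    (Filter.Eventually.of_forall fun x => by
      rw [Real.norm_of_nonneg (overlap_nonneg A B x)]; exact overlap_le_right A B x)

lemma integral_overlap {A B : Set 𝕋} (hA : MeasurableSet A) (hB : MeasurableSet B) :
    ∫ x, overlap A B x = volume.real A * volume.real B := by
  have hS := measurableSet_overlap hA hB
  have h := Measure.prod_apply (μ := (volume : Measure 𝕋)) (ν := (volume : Measure 𝕋)) hS
  rw [Measure.prod_apply_symm hS] at h
  unfold overlap
  rw [integral_eq_lintegral_of_nonneg_ae (Filter.Eventually.of_forall fun x => measureReal_nonneg)
    (measurable_overlap hA hB).aestronglyMeasurable]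
  simp only [measureReal_def, ENNReal.ofReal_toReal (measure_ne_top _ _)]
  rw [← ENNReal.toReal_mul]
  congr 1
  refine h.symm.trans ?_
  have (y : 𝕋) : volume ((fun x => (x, y)) ⁻¹' {p : 𝕋 × 𝕋 | p.2 ∈ B ∧ p.1 - p.2 ∈ A}) =
      B.indicator (fun _ => volume A) y := by
    by_cases hy : y ∈ B
    · rw [indicator_of_mem hy, ← volume_preimage_sub_right A y]
      congr 1
      ext x
      simp [hy]
    · simp [hy]
  simp_rw [this]
  rw [lintegral_indicator hB, setLIntegral_const]

lemma overlap_union_add_inter {A B C : Set 𝕋} (hA : MeasurableSet A)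
    (hC : MeasurableSet C) (x : 𝕋) :
    overlap A (B ∪ C) x + overlap A (B ∩ C) x = overlap A B x + overlap A C x := by
  have hm : MeasurableSet {b | b ∈ C ∧ x - b ∈ A} :=
    hC.inter (measurable_const.sub measurable_id hA)
  rw [overlap, overlap, overlap, overlap, ← measureReal_union_add_inter hm]
  congr 2
  · ext b; simp only [mem_ofPred_eq, mem_union]; tauto
  · ext b; simp only [mem_ofPred_eq, mem_inter_iff]; tauto

lemma overlap_mono {A B C : Set 𝕋} (h : B ⊆ C) (x : 𝕋) : overlap A B x ≤ overlap A C x :=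
  measureReal_mono fun _ hb => ⟨h hb.1, hb.2⟩

lemma overlap_preimage_sub (A B : Set 𝕋) (x y : 𝕋) :
    overlap A ((fun b => b - y) ⁻¹' B) x = overlap A B (x - y) := by
  rw [overlap, overlap, measureReal_def, measureReal_def,
    ← volume_preimage_sub_right {b | b ∈ B ∧ x - y - b ∈ A} y]
  congr 2
  ext b
  simp

/-- The excess of the overlap of `A` and `B` above the level `t`. -/
noncomputable def excess (A : Set 𝕋) (t : ℝ) (B : Set 𝕋) : ℝ :=
  ∫ x, max (overlap A B x - t) 0

lemma integrable_excess {A B : Set 𝕋} (hA : MeasurableSet A) (hB : MeasurableSet B) (t : ℝ) :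
    Integrable fun x => max (overlap A B x - t) 0 :=
  ((integrable_overlap hA hB).sub (integrable_const t)).sup (integrable_const 0)

lemma excess_add_le {A B C : Set 𝕋} (hA : MeasurableSet A) (hB : MeasurableSet B)
    (hC : MeasurableSet C) (t : ℝ) :
    excess A t B + excess A t C ≤ excess A t (B ∩ C) + excess A t (B ∪ C) := by
  unfold excess
  rw [← integral_add (integrable_excess hA hB t) (integrable_excess hA hC t),
    ← integral_add (integrable_excess hA (hB.inter hC) t) (integrable_excess hA (hB.union hC) t)]
  refine integral_mono ((integrable_excess hA hB t).add (integrable_excess hA hC t))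
    ((integrable_excess hA (hB.inter hC) t).add (integrable_excess hA (hB.union hC) t)) fun x => ?_
  have h := overlap_union_add_inter (B := B) hA hC x
  have h1 := overlap_mono (A := A) (inter_subset_left : B ∩ C ⊆ B) x
  have h2 := overlap_mono (A := A) (inter_subset_right : B ∩ C ⊆ C) x
  simp only [max_def]
  split_ifs <;> linarith

lemma excess_preimage_sub (A B : Set 𝕋) (t : ℝ) (y : 𝕋) :
    excess A t ((fun b => b - y) ⁻¹' B) = excess A t B := by
  simp only [excess, overlap_preimage_sub]
  exact integral_sub_right_eq_self (fun x => max (overlap A B x - t) 0) y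

lemma excess_eq_zero_of_le {A B : Set 𝕋} {t : ℝ} (h : ∀ x, overlap A B x ≤ t) :
    excess A t B = 0 := by
  simp [excess, h]

lemma excess_eq_of_ge {A B : Set 𝕋} (hA : MeasurableSet A) (hB : MeasurableSet B) {t : ℝ}
    (h : ∀ x, t ≤ overlap A B x) :
    excess A t B = volume.real A * volume.real B - t := by
  simp only [excess, max_eq_left (sub_nonneg.mpr (h _))]
  rw [integral_sub (integrable_overlap hA hB) (integrable_const t), integral_overlap hA hB]
  simp

lemma excess_le_one {A B : Set 𝕋} (hA : MeasurableSet A) (hB : MeasurableSet B) {t : ℝ}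
    (ht : 0 ≤ t) : excess A t B ≤ 1 := by
  calc excess A t B ≤ ∫ _ : 𝕋, (1 : ℝ) := by
        refine integral_mono (integrable_excess hA hB t) (integrable_const _) fun x => ?_
        have : overlap A B x ≤ 1 := measureReal_le_one
        exact max_le (by linarith) zero_le_one
    _ = 1 := by simp

lemma continuous_volume_inter_translate {B : Set 𝕋} (hB : MeasurableSet B) :
    Continuous fun y : 𝕋 => volume.real (B ∩ (fun b => b - y) ⁻¹' B) := by
  rw [continuous_iff_continuousAt]
  intro y
  let f : 𝕋 → C(𝕋, 𝕋) := fun y => ⟨fun b => b - y, by fun_prop⟩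
  have hf : Continuous f := ContinuousMap.continuous_of_continuous_uncurry f (by
    show Continuous fun p : 𝕋 × 𝕋 => p.2 - p.1
    fun_prop)
  have hp (y : 𝕋) : MeasurePreserving (f y) (volume : Measure 𝕋) volume :=
    measurePreserving_sub_right volume y
  have h := tendsto_measure_symmDiff_preimage_nhds_zero (hf.tendsto y)
    (Filter.Eventually.of_forall hp) (hp y) hB.nullMeasurableSet (measure_ne_top _ _)
  have h' := (ENNReal.tendsto_toReal ENNReal.zero_ne_top).comp h
  rw [ContinuousAt, tendsto_iff_norm_sub_tendsto_zero]
  refine squeeze_zero (fun _ => norm_nonneg _) (fun z => ?_) h'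
  have hm (z : 𝕋) : MeasurableSet (f z ⁻¹' B) := (f z).continuous.measurable hB
  have key (u v : 𝕋) : volume.real (B ∩ f u ⁻¹' B) - volume.real (B ∩ f v ⁻¹' B) ≤
      volume.real (symmDiff (f u ⁻¹' B) (f v ⁻¹' B)) := by
    rw [sub_le_iff_le_add']
    refine (measureReal_mono ?_).trans (measureReal_union_le _ _)
    intro b hb
    by_cases hv : b ∈ f v ⁻¹' B
    · exact Or.inl ⟨hb.1, hv⟩
    · exact Or.inr (Or.inl ⟨hb.2, hv⟩)
  rw [Real.norm_eq_abs, abs_le]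
  have h1 := key y z
  have h2 := key z y
  rw [symmDiff_comm] at h1
  simp only [measureReal_def] at h1 h2 ⊢
  constructor
  · rw [neg_le, neg_sub]; exact h1
  · exact h2

lemma exists_volume_inter_translate_eq {B : Set 𝕋} (hB : MeasurableSet B) {r : ℝ}
    (h1 : volume.real B * volume.real B ≤ r) (h2 : r ≤ volume.real B) :
    ∃ y : 𝕋, volume.real (B ∩ (fun b => b - y) ⁻¹' B) = r := by
  refine mem_range_of_exists_le_of_exists_ge (continuous_volume_inter_translate hB) ?_ ⟨0, by simpa⟩
  have h_integral := integral_overlap hB.neg hB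
  obtain ⟨y, hy⟩ := exists_le_integral (integrable_overlap hB.neg hB)
  refine ⟨y, le_trans ?_ h1⟩
  rw [h_integral] at hy
  have h3 : volume.real (-B) = volume.real B := by
    rw [measureReal_def, measureReal_def, Measure.measure_neg]
  rw [h3] at hy
  refine le_trans (le_of_eq ?_) hy
  rw [overlap]
  congr 1
  ext b
  simp

/-- Pollard's inequality on the circle. -/
lemma excess_le {A B : Set 𝕋} (hA : MeasurableSet A) (hB : MeasurableSet B) {t : ℝ}
    (ht0 : 0 ≤ t) (htA : t ≤ volume.real A) (htB : t ≤ volume.real B)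
    (hAB : volume.real A + volume.real B - 1 ≤ t) :
    excess A t B ≤ (volume.real A - t) * (volume.real B - t) := by
  rcases ht0.eq_or_lt with rfl | ht
  · rw [excess_eq_of_ge hA hB (overlap_nonneg A B)]; simp
  rcases htA.eq_or_lt with hAt | htA'
  · rw [excess_eq_zero_of_le fun x => hAt ▸ overlap_le_left A B x, ← hAt]; simp
  set α := volume.real A with hα
  have hα1 : α ≤ 1 := measureReal_le_one
  set P : Set 𝕋 → Prop := fun B =>
    MeasurableSet B ∧ t ≤ volume.real B ∧ volume.real B ≤ 1 - α + t with hP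
  set D : Set 𝕋 → ℝ := fun B => excess A t B - (α - t) * (volume.real B - t) with hD
  have hbot {B : Set 𝕋} (hs : volume.real B = t) : D B = 0 := by
    simp only [hD, hs]
    rw [excess_eq_zero_of_le fun x => hs ▸ overlap_le_right A B x]; simp
  have htop {B : Set 𝕋} (hB : MeasurableSet B) (hs : volume.real B = 1 - α + t) : D B = 0 := by
    simp only [hD]
    rw [excess_eq_of_ge hA hB fun x => by have := le_overlap hA B x; rw [hs] at this; linarith,
      hs, ← hα]
    ring
  have hsub {B : Set 𝕋} (hB : MeasurableSet B) {ε : ℝ} (hε : 0 ≤ ε)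
      (hε' : ε ≤ volume.real B - volume.real B * volume.real B) :
      ∃ B₁ B₂ : Set 𝕋, MeasurableSet B₁ ∧ MeasurableSet B₂ ∧
        volume.real B₁ = volume.real B - ε ∧ volume.real B₂ = volume.real B + ε ∧
        2 * D B ≤ D B₁ + D B₂ := by
    obtain ⟨y, hy⟩ := exists_volume_inter_translate_eq hB (r := volume.real B - ε)
      (by linarith) (by linarith)
    have hB' : MeasurableSet ((fun b => b - y) ⁻¹' B) := (measurable_id.sub_const y) hB
    have hv : volume.real ((fun b => b - y) ⁻¹' B) = volume.real B := by
      rw [measureReal_def, measureReal_def, volume_preimage_sub_right]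
    have hu := measureReal_union_add_inter (μ := (volume : Measure 𝕋)) (s := B) hB'
    have he := excess_add_le hA hB hB' t
    rw [excess_preimage_sub] at he
    have hu' : volume.real (B ∪ (fun b => b - y) ⁻¹' B) = volume.real B + ε := by linarith
    refine ⟨_, _, hB.inter hB', hB.union hB', hy, hu', ?_⟩
    simp only [hD, hy, hu']
    linarith
  set ε₀ := min (t * (1 - t)) ((1 - α + t) * (α - t)) with hε₀
  have hε₀pos : 0 < ε₀ := lt_min (mul_pos ht (by linarith)) (mul_pos (by linarith) (by linarith))
  have hε₀le {s : ℝ} (h1 : t ≤ s) (h2 : s ≤ 1 - α + t) : ε₀ ≤ s - s * s := by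
    rcases le_total s (1 - t) with h | h
    · exact (min_le_left _ _).trans (by nlinarith)
    · exact (min_le_right _ _).trans (by nlinarith)
  have hstep {M : ℝ} (hM : 0 ≤ M) (hbound : ∀ B, P B → D B ≤ M) (k : ℕ) :
      ∀ B, P B → volume.real B ≤ t + k * ε₀ → D B ≤ (1 - (1 / 2) ^ k) * M := by
    induction k with
    | zero =>
      intro B hB hs
      rw [hbot (le_antisymm (by simpa using hs) hB.2.1)]
      simp
    | succ k ih =>
      intro B hB hs
      have hpow : (1 / 2 : ℝ) ^ (k + 1) = (1 / 2) ^ k / 2 := by ring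
      have hpow1 : (1 / 2 : ℝ) ^ k ≤ 1 := pow_le_one₀ (by norm_num) (by norm_num)
      have hhalf : M / 2 ≤ (1 - (1 / 2) ^ (k + 1)) * M := by
        rw [hpow]; nlinarith
      set s := volume.real B with hs_def
      obtain ⟨ε, hε0, hεε, hεb, hεt, hcase⟩ : ∃ ε, 0 ≤ ε ∧ ε ≤ ε₀ ∧ ε ≤ s - t ∧
          ε ≤ 1 - α + t - s ∧ (ε = ε₀ ∨ ε = s - t ∨ ε = 1 - α + t - s) := by
        refine ⟨min ε₀ (min (s - t) (1 - α + t - s)),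
          le_min hε₀pos.le (le_min (sub_nonneg.mpr hB.2.1) (sub_nonneg.mpr hB.2.2)),
          min_le_left _ _, (min_le_right _ _).trans (min_le_left _ _),
          (min_le_right _ _).trans (min_le_right _ _), ?_⟩
        rcases min_choice ε₀ (min (s - t) (1 - α + t - s)) with h | h
        · exact Or.inl h
        · rw [h]; exact Or.inr (min_choice _ _)
      obtain ⟨B₁, B₂, hm1, hm2, hv1, hv2, hconc⟩ :=
        hsub hB.1 hε0 (hεε.trans (hε₀le hB.2.1 hB.2.2))
      have hP1 : P B₁ := ⟨hm1, by linarith, by linarith⟩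
      have hP2 : P B₂ := ⟨hm2, by linarith, by linarith⟩
      have hD1 := hbound _ hP1
      have hD2 := hbound _ hP2
      rcases hcase with h | h | h
      · have := ih B₁ hP1 (by push_cast at hs; linarith)
        rw [hpow]
        linarith
      · rw [hbot (B := B₁) (by linarith)] at hconc
        linarith
      · rw [htop hm2 (by linarith)] at hconc
        linarith
  obtain ⟨K, hK⟩ := exists_nat_ge (1 / ε₀)
  have hK' : 1 ≤ K * ε₀ := by rwa [div_le_iff₀ hε₀pos] at hK
  set θ : ℝ := 1 - (1 / 2) ^ K with hθ
  have hθ0 : 0 ≤ θ := sub_nonneg.mpr (pow_le_one₀ (by norm_num) (by norm_num))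
  have hθ1 : θ < 1 := sub_lt_self _ (by positivity)
  have hgeom (j : ℕ) : ∀ B, P B → D B ≤ θ ^ j := by
    induction j with
    | zero =>
      intro B hB
      have h1 := excess_le_one hA hB.1 ht0
      have h2 : 0 ≤ (α - t) * (volume.real B - t) :=
        mul_nonneg (by linarith) (by linarith [hB.2.1])
      simp only [hD, pow_zero]
      linarith
    | succ j ih =>
      intro B hB
      rw [pow_succ']
      exact hstep (by positivity) ih K B hB (by linarith [hB.2.2])
  have hlim := tendsto_pow_atTop_nhds_zero_of_lt_one hθ0 hθ1
  have := ge_of_tendsto' hlim fun j => hgeom j B ⟨hB, htB, by linarith⟩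
  simp only [hD] at this
  linarith

/-- The overlap of two arcs of half-lengths `a` and `b` centred at `0`. -/
noncomputable def arcOverlap (a b : ℝ) (x : 𝕋) : ℝ :=
  max (max 0 (2 * a + 2 * b - 1)) (min (min (2 * a) (2 * b)) (a + b - ‖x‖))

lemma continuous_arcOverlap (a b : ℝ) : Continuous (arcOverlap a b) := by
  unfold arcOverlap
  fun_prop

lemma integrable_arcOverlap (a b : ℝ) : Integrable (arcOverlap a b) :=
  (continuous_arcOverlap a b).integrable_of_hasCompactSupport (HasCompactSupport.of_compactSpace _)

lemma arcOverlap_antitone (a b : ℝ) {x y : 𝕋} (h : ‖x‖ ≤ ‖y‖) :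
    arcOverlap a b y ≤ arcOverlap a b x := by
  unfold arcOverlap
  gcongr

lemma exists_coe_eq_norm_eq_abs (x : 𝕋) : ∃ r : ℝ, (r : 𝕋) = x ∧ ‖x‖ = |r| ∧ |r| ≤ 1 / 2 := by
  obtain ⟨r, hr, rfl⟩ : ∃ r ∈ Ico (-(1 / 2) : ℝ) (-(1 / 2) + 1), (r : 𝕋) = x := by
    have h := AddCircle.coe_image_Ico_eq (1 : ℝ) (-(1 / 2))
    exact (h ▸ mem_univ x : x ∈ _)
  have hr' : |r| ≤ 1 / 2 := abs_le.mpr ⟨hr.1, by linarith [hr.2]⟩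
  exact ⟨r, rfl, (AddCircle.norm_coe_eq_abs_iff 1 one_ne_zero).mpr (by simpa using hr'), hr'⟩

lemma image_coe_Icc {a : ℝ} (ha : a ≤ 1 / 2) :
    (fun r : ℝ => (r : 𝕋)) '' Icc (-a) a = Metric.closedBall 0 a := by
  ext x
  rw [mem_closedBall_zero_iff]
  constructor
  · rintro ⟨r, hr, rfl⟩
    have : |r| ≤ a := abs_le.mpr hr
    exact ((AddCircle.norm_coe_eq_abs_iff 1 one_ne_zero).mpr (by simpa using this.trans ha)).trans_le
      this
  · intro hx
    obtain ⟨r, rfl, hr, -⟩ := exists_coe_eq_norm_eq_abs x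
    exact ⟨r, abs_le.mp (hr ▸ hx), rfl⟩

lemma volume_real_closedBall (x : 𝕋) {a : ℝ} (ha0 : 0 ≤ a) (ha : a ≤ 1 / 2) :
    volume.real (Metric.closedBall x a) = 2 * a := by
  rw [measureReal_def, AddCircle.volume_closedBall, min_eq_right (by linarith),
    ENNReal.toReal_ofReal (by linarith)]

lemma arcOverlap_le_overlap {a b : ℝ} (ha0 : 0 ≤ a) (ha : a ≤ 1 / 2) (hb0 : 0 ≤ b)
    (hb : b ≤ 1 / 2) (x : 𝕋) :
    arcOverlap a b x ≤ overlap (Metric.closedBall 0 a) (Metric.closedBall 0 b) x := by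
  have hbase := le_overlap (A := Metric.closedBall 0 a) measurableSet_closedBall
    (Metric.closedBall 0 b) x
  rw [volume_real_closedBall 0 ha0 ha, volume_real_closedBall 0 hb0 hb] at hbase
  refine max_le (max_le (overlap_nonneg _ _ _) hbase) ?_
  set L := min (min (2 * a) (2 * b)) (a + b - ‖x‖) with hL
  rcases le_total L 0 with hL0 | hL0
  · exact hL0.trans (overlap_nonneg _ _ _)
  have hLa : L ≤ 2 * a := (min_le_left _ _).trans (min_le_left _ _)
  have hLb : L ≤ 2 * b := (min_le_left _ _).trans (min_le_right _ _)
  have hLx : L ≤ a + b - ‖x‖ := min_le_right _ _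
  obtain ⟨r, rfl, hr, -⟩ := exists_coe_eq_norm_eq_abs x
  obtain ⟨m, hm1, hm2⟩ : ∃ m : ℝ, |m| ≤ b - L / 2 ∧ |r - m| ≤ a - L / 2 := by
    have hrab : |r| ≤ a + b - L := by linarith
    rw [abs_le] at hrab
    refine ⟨max (-(b - L / 2)) (r - (a - L / 2)), abs_le.mpr ⟨le_max_left _ _, max_le ?_ ?_⟩,
      abs_le.mpr ⟨?_, ?_⟩⟩
    · linarith
    · linarith
    · rw [neg_le, neg_sub, sub_le_iff_le_add]
      exact max_le (by linarith) (by linarith)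
    · linarith [le_max_right (-(b - L / 2)) (r - (a - L / 2))]
  have hnorm (s : ℝ) : ‖(s : 𝕋)‖ ≤ |s| := QuotientAddGroup.norm_mk_le_norm
  rw [show L = volume.real (Metric.closedBall (m : 𝕋) (L / 2)) by
    rw [volume_real_closedBall _ (by linarith) (by linarith)]; ring]
  refine measureReal_mono fun y hy => ?_
  rw [mem_closedBall_iff_norm] at hy
  constructor
  · rw [mem_closedBall_zero_iff]
    have := norm_add_le (y - (m : 𝕋)) m
    rw [sub_add_cancel] at this
    linarith [hnorm m]
  · rw [mem_closedBall_zero_iff]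
    have := norm_sub_le ((r - m : ℝ) : 𝕋) (y - (m : 𝕋))
    rw [AddCircle.coe_sub, sub_sub_sub_cancel_right, ← AddCircle.coe_sub] at this
    linarith [hnorm (r - m)]

lemma le_integral_arcOverlap_excess {a b t : ℝ} (ht0 : 0 ≤ t)
    (ht : 2 * a + 2 * b - 1 ≤ t) (hta : t ≤ 2 * a) (htb : t ≤ 2 * b) :
    (2 * a - t) * (2 * b - t) ≤ ∫ x, max (arcOverlap a b x - t) 0 := by
  wlog hba : b ≤ a generalizing a b
  · have h := this (by linarith : 2 * b + 2 * a - 1 ≤ t) htb hta (le_of_not_ge hba)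
    have hsymm : arcOverlap a b = arcOverlap b a := by
      ext x
      simp only [arcOverlap, min_comm (2 * a), add_comm a b, add_comm (2 * a)]
    rw [hsymm]
    linarith
  set F : ℝ → ℝ := fun r => max (arcOverlap a b (r : 𝕋) - t) 0 with hF
  have hFc : Continuous F :=
    (((continuous_arcOverlap a b).comp (AddCircle.continuous_mk' 1)).sub
      continuous_const).max continuous_const
  have hFi (u v : ℝ) : IntervalIntegrable F volume u v := hFc.intervalIntegrable u v
  have hF0 (r : ℝ) : 0 ≤ F r := le_max_right _ _
  set c := a + b - t with hc
  set d := a - b with hd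
  have hFle {r s : ℝ} (h1 : s ≤ 2 * b - t) (h2 : s ≤ c - |r|) : s ≤ F r := by
    have hnorm : ‖(r : 𝕋)‖ ≤ |r| := QuotientAddGroup.norm_mk_le_norm
    refine le_max_of_le_left (le_sub_iff_add_le.mpr (le_max_of_le_right (le_min (le_min ?_ ?_) ?_)))
    all_goals linarith
  have e : ∫ x, max (arcOverlap a b x - t) 0 = ∫ r in (-(1 / 2) : ℝ)..(1 / 2), F r := by
    rw [← AddCircle.intervalIntegral_preimage 1 (-(1 / 2))]
    norm_num [hF]
  have hmono : ∫ r in (-c)..c, F r ≤ ∫ r in (-(1 / 2) : ℝ)..(1 / 2), F r :=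
    intervalIntegral.integral_mono_interval (by linarith) (by linarith) (by linarith)
      (Filter.Eventually.of_forall hF0) (hFi _ _)
  have hs1 := intervalIntegral.integral_add_adjacent_intervals (hFi (-c) (-d)) (hFi (-d) d)
  have hs2 := intervalIntegral.integral_add_adjacent_intervals (hFi (-c) d) (hFi d c)
  have h1 : ∫ r in (-c)..(-d), (c + r) ≤ ∫ r in (-c)..(-d), F r :=
    intervalIntegral.integral_mono_on (by linarith) (Continuous.intervalIntegrable (by fun_prop) _ _)
      (hFi _ _) fun r hr => hFle (by linarith [hr.2])
        (by rw [abs_of_nonpos (by linarith [hr.2])]; linarith)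
  have h2 : ∫ r in (-d)..d, (2 * b - t) ≤ ∫ r in (-d)..d, F r :=
    intervalIntegral.integral_mono_on (by linarith) (Continuous.intervalIntegrable (by fun_prop) _ _)
      (hFi _ _) fun r hr => hFle le_rfl (by linarith [abs_le.mpr hr])
  have h3 : ∫ r in d..c, (c - r) ≤ ∫ r in d..c, F r :=
    intervalIntegral.integral_mono_on (by linarith) (Continuous.intervalIntegrable (by fun_prop) _ _)
      (hFi _ _) fun r hr => hFle (by linarith [hr.1])
        (by rw [abs_of_nonneg (by linarith [hr.1])])
  rw [intervalIntegral.integral_add (by simp) (by simp), intervalIntegral.integral_const,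
    integral_id, smul_eq_mul] at h1
  rw [intervalIntegral.integral_const, smul_eq_mul] at h2
  rw [intervalIntegral.integral_sub (by simp) (by simp), intervalIntegral.integral_const,
    integral_id, smul_eq_mul] at h3
  rw [e]
  refine le_trans (le_of_eq ?_) ((add_le_add (add_le_add h1 h2) h3).trans (by linarith))
  rw [hc, hd]
  ring

lemma le_integral_arcOverlap {a b : ℝ} (ha0 : 0 ≤ a) (ha : a ≤ 1 / 2) (hb0 : 0 ≤ b)
    (hb : b ≤ 1 / 2) : 2 * a * (2 * b) ≤ ∫ x, arcOverlap a b x := by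
  set t := max 0 (2 * a + 2 * b - 1) with ht
  have ht0 : 0 ≤ t := le_max_left _ _
  have ht1 : 2 * a + 2 * b - 1 ≤ t := le_max_right _ _
  have hta : t ≤ 2 * a := max_le (by linarith) (by linarith)
  have htb : t ≤ 2 * b := max_le (by linarith) (by linarith)
  have h := le_integral_arcOverlap_excess ht0 ht1 hta htb
  have hge (x : 𝕋) : 0 ≤ arcOverlap a b x - t := sub_nonneg.mpr (le_max_left _ _)
  simp only [fun x => max_eq_left (hge x)] at h
  rw [integral_sub (integrable_arcOverlap a b) (integrable_const t)] at h
  simp only [integral_const, probReal_univ, one_smul] at h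
  have : t * (t - (2 * a + 2 * b - 1)) = 0 := by
    rcases max_choice 0 (2 * a + 2 * b - 1) with h | h <;> rw [ht, h] <;> ring
  linarith

lemma integral_overlap_closedBall {a b : ℝ} (ha0 : 0 ≤ a) (ha : a ≤ 1 / 2) (hb0 : 0 ≤ b)
    (hb : b ≤ 1 / 2) :
    ∫ x, overlap (Metric.closedBall 0 a) (Metric.closedBall 0 b) x = 2 * a * (2 * b) := by
  rw [integral_overlap measurableSet_closedBall measurableSet_closedBall,
    volume_real_closedBall 0 ha0 ha, volume_real_closedBall 0 hb0 hb]

lemma integral_arcOverlap {a b : ℝ} (ha0 : 0 ≤ a) (ha : a ≤ 1 / 2) (hb0 : 0 ≤ b)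
    (hb : b ≤ 1 / 2) : ∫ x, arcOverlap a b x = 2 * a * (2 * b) := by
  refine le_antisymm ?_ (le_integral_arcOverlap ha0 ha hb0 hb)
  rw [← integral_overlap_closedBall ha0 ha hb0 hb]
  exact integral_mono (integrable_arcOverlap a b)
    (integrable_overlap measurableSet_closedBall measurableSet_closedBall)
    (arcOverlap_le_overlap ha0 ha hb0 hb)

lemma arcOverlap_ae_eq_overlap {a b : ℝ} (ha0 : 0 ≤ a) (ha : a ≤ 1 / 2) (hb0 : 0 ≤ b)
    (hb : b ≤ 1 / 2) :
    arcOverlap a b =ᵐ[volume] overlap (Metric.closedBall 0 a) (Metric.closedBall 0 b) := by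
  refine (integral_eq_iff_of_ae_le (integrable_arcOverlap a b)
    (integrable_overlap measurableSet_closedBall measurableSet_closedBall)
    (Filter.Eventually.of_forall (arcOverlap_le_overlap ha0 ha hb0 hb))).mp ?_
  rw [integral_arcOverlap ha0 ha hb0 hb, integral_overlap_closedBall ha0 ha hb0 hb]

lemma excess_le_integral_arcOverlap_excess {a b : ℝ} (ha0 : 0 ≤ a) (ha : a ≤ 1 / 2) (hb0 : 0 ≤ b)
    (hb : b ≤ 1 / 2) {A B : Set 𝕋} (hA : MeasurableSet A) (hB : MeasurableSet B)
    (hAa : volume.real A = 2 * a) (hBb : volume.real B = 2 * b) (t : ℝ) :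
    excess A t B ≤ ∫ x, max (arcOverlap a b x - t) 0 := by
  have htriv (h : ∀ x, t ≤ overlap A B x) :
      excess A t B ≤ ∫ x, max (arcOverlap a b x - t) 0 := by
    rw [excess_eq_of_ge hA hB h, hAa, hBb, ← integral_arcOverlap ha0 ha hb0 hb]
    calc (∫ x, arcOverlap a b x) - t = ∫ x, (arcOverlap a b x - t) := by
          rw [integral_sub (integrable_arcOverlap a b) (integrable_const t)]
          simp
      _ ≤ _ := integral_mono ((integrable_arcOverlap a b).sub (integrable_const t))
          (((integrable_arcOverlap a b).sub (integrable_const t)).sup (integrable_const 0))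
          fun x => le_max_left _ _
  have hnonneg : 0 ≤ ∫ x, max (arcOverlap a b x - t) 0 :=
    integral_nonneg fun x => le_max_right _ _
  rcases le_or_gt t 0 with h0 | h0
  · exact htriv fun x => h0.trans (overlap_nonneg A B x)
  rcases le_or_gt t (2 * a + 2 * b - 1) with h1 | h1
  · exact htriv fun x => (by rw [hAa, hBb]; exact h1 : t ≤ _).trans (le_overlap hA B x)
  rcases le_or_gt (2 * a) t with h2 | h2
  · rwa [excess_eq_zero_of_le fun x => (overlap_le_left A B x).trans (hAa.trans_le h2)]
  rcases le_or_gt (2 * b) t with h3 | h3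
  · rwa [excess_eq_zero_of_le fun x => (overlap_le_right A B x).trans (hBb.trans_le h3)]
  have h := excess_le hA hB h0.le (by linarith) (by linarith) (by linarith)
  rw [hAa, hBb] at h
  exact h.trans (le_integral_arcOverlap_excess h0.le h1.le h2.le h3.le)

lemma lintegral_ofReal_const_sub {f : 𝕋 → ℝ} (hf : Integrable f) (t : ℝ) :
    ∫⁻ x, ENNReal.ofReal (t - f x) =
      ENNReal.ofReal (t - (∫ x, f x) + ∫ x, max (f x - t) 0) := by
  have hi : Integrable fun x => max (f x - t) 0 :=
    (hf.sub (integrable_const t)).sup (integrable_const 0)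
  have hi₁ : Integrable fun x => t - f x := (integrable_const t).sub hf
  have hi₂ : Integrable fun x => max (t - f x) 0 := hi₁.sup (integrable_const 0)
  have he : t - (∫ x, f x) + ∫ x, max (f x - t) 0 = ∫ x, max (t - f x) 0 := by
    have hpt (x : 𝕋) : max (t - f x) 0 = t - f x + max (f x - t) 0 := by
      rcases le_total t (f x) with h | h
      · rw [max_eq_right (by linarith), max_eq_left (by linarith)]; ring
      · rw [max_eq_left (by linarith), max_eq_right (by linarith)]; ring
    simp_rw [hpt]
    rw [integral_add hi₁ hi, integral_sub (integrable_const t) hf]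
    simp
  rw [he, ofReal_integral_eq_lintegral_ofReal hi₂
    (Filter.Eventually.of_forall fun x => le_max_right _ _)]
  refine lintegral_congr fun x => ?_
  rw [ENNReal.ofReal_max, ENNReal.ofReal_zero, max_eq_left zero_le]

lemma measurableSet_forall_sub_notMem {n : ℕ} {A : Fin n → Set 𝕋}
    (hA : ∀ i, MeasurableSet (A i)) :
    MeasurableSet {p : (Fin n → 𝕋) × 𝕋 | ∀ i, p.2 - p.1 i ∉ A i} := by
  rw [ofPred_forall]
  exact MeasurableSet.iInter fun i =>
    (by fun_prop : Measurable fun p : (Fin n → 𝕋) × 𝕋 => p.2 - p.1 i) (hA i).compl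

lemma compl_iUnion_image_add {n : ℕ} (A : Fin n → Set 𝕋) (b : Fin n → 𝕋) :
    (⋃ i, (· + b i) '' (A i))ᶜ = {x | ∀ i, x - b i ∉ A i} := by
  ext x
  simp [sub_eq_add_neg]

lemma volume_inter_sub_notMem {A B : Set 𝕋} (hA : MeasurableSet A) (hB : MeasurableSet B) (x : 𝕋) :
    volume {b | b ∈ B ∧ x - b ∉ A} = ENNReal.ofReal (volume.real B - overlap A B x) := by
  have hm : MeasurableSet {b | b ∈ B ∧ x - b ∈ A} := hB.inter (measurable_id.const_sub x hA)
  have h := measureReal_sdiff (μ := (volume : Measure 𝕋))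
    (fun b hb => hb.1 : {b | b ∈ B ∧ x - b ∈ A} ⊆ B) hm
  rw [overlap, ← h, ofReal_measureReal]
  congr 1
  ext b
  simp only [mem_ofPred_eq, mem_sdiff]
  tauto

lemma setLIntegral_volume_compl_iUnion {n : ℕ} {A B : Fin n → Set 𝕋}
    (hA : ∀ i, MeasurableSet (A i)) (hB : ∀ i, MeasurableSet (B i)) :
    ∫⁻ b in univ.pi B, volume (⋃ i, (· + b i) '' (A i))ᶜ =
      ∫⁻ x, ∏ i, ENNReal.ofReal (volume.real (B i) - overlap (A i) (B i) x) := by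
  have hBpi : MeasurableSet (univ.pi B) := MeasurableSet.univ_pi hB
  have hS : MeasurableSet {p : (Fin n → 𝕋) × 𝕋 | p.1 ∈ univ.pi B ∧ ∀ i, p.2 - p.1 i ∉ A i} :=
    (measurable_fst hBpi).inter (measurableSet_forall_sub_notMem hA)
  have h := Measure.prod_apply (μ := (volume : Measure (Fin n → 𝕋)))
    (ν := (volume : Measure 𝕋)) hS
  rw [Measure.prod_apply_symm hS] at h
  rw [← lintegral_indicator hBpi]
  refine Eq.trans (lintegral_congr fun b => ?_) (h.symm.trans (lintegral_congr fun x => ?_))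
  · by_cases hb : b ∈ univ.pi B
    · rw [indicator_of_mem hb, compl_iUnion_image_add]
      congr 1
      ext x
      simp only [mem_ofPred_eq, mem_preimage]
      exact (and_iff_right hb).symm
    · rw [indicator_of_notMem hb]
      symm
      convert measure_empty (μ := (volume : Measure 𝕋))
      ext x
      simp only [mem_ofPred_eq, mem_preimage, mem_empty_iff_false, iff_false]
      exact fun hx => hb hx.1
  · have : (fun b : Fin n → 𝕋 => (b, x)) ⁻¹' {p | p.1 ∈ univ.pi B ∧ ∀ i, p.2 - p.1 i ∉ A i} =
        univ.pi fun i => {b | b ∈ B i ∧ x - b ∉ A i} := by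
      ext b
      simp only [mem_preimage, mem_ofPred_eq, mem_pi, mem_univ, true_implies, forall_and]
    rw [this, volume_pi_pi]
    exact Finset.prod_congr rfl fun i _ => volume_inter_sub_notMem (hA i) (hB i) x

lemma setLIntegral_volume_iUnion_add_compl {n : ℕ} {A : Fin n → Set 𝕋} (B : Fin n → Set 𝕋)
    (hA : ∀ i, MeasurableSet (A i)) :
    (∫⁻ b in univ.pi B, volume (⋃ i, (· + b i) '' (A i))) +
      ∫⁻ b in univ.pi B, volume (⋃ i, (· + b i) '' (A i))ᶜ = ∏ i, volume (B i) := by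
  have hm : Measurable fun b : Fin n → 𝕋 => volume (⋃ i, (· + b i) '' (A i))ᶜ := by
    simp_rw [compl_iUnion_image_add]
    exact measurable_measure_prodMk_left (measurableSet_forall_sub_notMem hA)
  rw [← lintegral_add_right _ hm]
  have h1 (b : Fin n → 𝕋) :
      volume (⋃ i, (· + b i) '' (A i)) + volume (⋃ i, (· + b i) '' (A i))ᶜ = 1 := by
    have : MeasurableSet (⋃ i, (· + b i) '' (A i)) :=
      MeasurableSet.iUnion fun i => (measurableEmbedding_addRight (b i)).measurableSet_image.mpr (hA i)
    rw [measure_add_measure_compl this, measure_univ]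
  simp_rw [h1]
  rw [setLIntegral_one, volume_pi_pi]

theorem stmt7 (n : ℕ) (hn : 1 ≤ n)
    (A B : Fin n → Set 𝕋)
    (hAm : ∀ i, MeasurableSet (A i)) (hBm : ∀ i, MeasurableSet (B i))
    (hA0 : ∀ i, 0 < volume (A i)) (hB0 : ∀ i, 0 < volume (B i))
    (a b : Fin n → ℝ)
    (ha : ∀ i, 0 ≤ a i ∧ a i ≤ 1 / 2) (hb : ∀ i, 0 ≤ b i ∧ b i ≤ 1 / 2)
    (A' B' : Fin n → Set 𝕋)
    (hA' : ∀ i, A' i = (fun r : ℝ => (r : 𝕋)) '' Set.Icc (-(a i)) (a i))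
    (hB' : ∀ i, B' i = (fun r : ℝ => (r : 𝕋)) '' Set.Icc (-(b i)) (b i))
    (hvA : ∀ i, volume (A' i) = volume (A i)) (hvB : ∀ i, volume (B' i) = volume (B i)) :
    expUnionT1 A B ≥ expUnionT1 A' B' := by
  have hA'' (i : Fin n) : A' i = Metric.closedBall 0 (a i) := by rw [hA', image_coe_Icc (ha i).2]
  have hB'' (i : Fin n) : B' i = Metric.closedBall 0 (b i) := by rw [hB', image_coe_Icc (hb i).2]
  have hA'm (i : Fin n) : MeasurableSet (A' i) := hA'' i ▸ measurableSet_closedBall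
  have hB'm (i : Fin n) : MeasurableSet (B' i) := hB'' i ▸ measurableSet_closedBall
  have hAa (i : Fin n) : volume.real (A i) = 2 * a i := by
    rw [measureReal_def, ← hvA, hA'', ← measureReal_def, volume_real_closedBall 0 (ha i).1 (ha i).2]
  have hBb (i : Fin n) : volume.real (B i) = 2 * b i := by
    rw [measureReal_def, ← hvB, hB'', ← measureReal_def, volume_real_closedBall 0 (hb i).1 (hb i).2]
  have hB'b (i : Fin n) : volume.real (B' i) = 2 * b i := by
    rw [hB'', volume_real_closedBall 0 (hb i).1 (hb i).2]
  have hcompl : ∫⁻ b in univ.pi B, volume (⋃ i, (· + b i) '' (A i))ᶜ ≤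
      ∫⁻ b in univ.pi B', volume (⋃ i, (· + b i) '' (A' i))ᶜ := by
    rw [setLIntegral_volume_compl_iUnion hAm hBm, setLIntegral_volume_compl_iUnion hA'm hB'm]
    have hae : ∀ᵐ x : 𝕋, ∏ i, ENNReal.ofReal (volume.real (B' i) - overlap (A' i) (B' i) x) =
        ∏ i, ENNReal.ofReal (2 * b i - arcOverlap (a i) (b i) x) := by
      have hi : ∀ᵐ x : 𝕋, ∀ i, arcOverlap (a i) (b i) x = overlap (A' i) (B' i) x :=
        ae_all_iff.mpr fun i => by
          rw [hA'', hB'']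
          exact arcOverlap_ae_eq_overlap (ha i).1 (ha i).2 (hb i).1 (hb i).2
      filter_upwards [hi] with x hx
      simp only [hx, hB'b]
    rw [lintegral_congr_ae hae]
    refine lintegral_prod_le_of_majorized volume
      (fun i => (measurable_overlap (hAm i) (hBm i)).const_sub _)
      (fun i => (continuous_arcOverlap (a i) (b i)).measurable.const_sub _) (fun i c _ => ?_)
      (fun x y => ?_)
    · simp only [sub_right_comm _ _ c, hBb]
      rw [lintegral_ofReal_const_sub (integrable_overlap (hAm i) (hBm i)),
        lintegral_ofReal_const_sub (integrable_arcOverlap (a i) (b i)),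
        integral_overlap (hAm i) (hBm i),
        integral_arcOverlap (ha i).1 (ha i).2 (hb i).1 (hb i).2, hAa, hBb]
      refine ENNReal.ofReal_le_ofReal (add_le_add le_rfl ?_)
      exact excess_le_integral_arcOverlap_excess (ha i).1 (ha i).2 (hb i).1 (hb i).2 (hAm i) (hBm i)
        (hAa i) (hBb i) _
    · rcases le_total ‖x‖ ‖y‖ with h | h
      · exact Or.inl fun i => sub_le_sub_left (arcOverlap_antitone _ _ h) _
      · exact Or.inr fun i => sub_le_sub_left (arcOverlap_antitone _ _ h) _
  have hsum := setLIntegral_volume_iUnion_add_compl B hAm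
  have hsum' := setLIntegral_volume_iUnion_add_compl B' hA'm
  simp only [hvB] at hsum'
  have hfin : ∏ i, volume (B i) ≠ ∞ := ENNReal.prod_ne_top fun i _ => measure_ne_top _ _
  have hle : ∫⁻ b in univ.pi B', volume (⋃ i, (· + b i) '' (A' i)) ≤
      ∫⁻ b in univ.pi B, volume (⋃ i, (· + b i) '' (A i)) := by
    have hne := ne_top_of_le_ne_top hfin (le_add_self.trans_eq hsum')
    rw [← ENNReal.add_le_add_iff_right hne, hsum', ← hsum]
    gcongr
  have hne : ∏ i, volume (B i) ≠ 0 := Finset.prod_ne_zero_iff.mpr fun i _ => (hB0 i).ne'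
  unfold expUnionT1
  simp only [hvB]
  refine ENNReal.toReal_mono (ENNReal.mul_ne_top (ENNReal.inv_ne_top.mpr hne)
    (ne_top_of_le_ne_top hfin (le_self_add.trans_eq hsum))) ?_
  gcongr
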